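/- For every y > 0: the function x ↦ φ(x,y) is strictly decreasing on the interval [π, 2π], satisfies φ(π,y) = 1 + exp(π·y) > 0 and φ(2π,y) = 1 − exp(2π·y) < 0, and consequently there exists a unique x̂ ∈ (π, 2π) with φ(x̂,y) = 0. -/

import Mathlib

/-- The auxiliary function of Lemma 3.1: `φ(x,y) = 1 − exp(x·y)·(cos x − y·sin x)`. -/
noncomputable def phi (x y : ℝ) : ℝ :=
  1 - Real.exp (x * y) * (Real.cos x - y * Real.sin x)

lemma hasDerivAt_phi (x y : ℝ) :
    HasDerivAt (fun x => phi x y) (Real.exp (x * y) * (1 + y ^ 2) * Real.sin x) x := by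
  have hexp : HasDerivAt (fun x => Real.exp (x * y)) (Real.exp (x * y) * y) x := by
    simpa using ((hasDerivAt_id x).mul_const y).exp
  have htrig := (Real.hasDerivAt_cos x).sub ((Real.hasDerivAt_sin x).const_mul y)
  refine ((hexp.mul htrig).const_sub 1).congr_deriv ?_
  simp only [Pi.sub_apply]
  ring

lemma continuous_phi_left (y : ℝ) : Continuous fun x => phi x y :=
  continuous_iff_continuousAt.2 fun x => (hasDerivAt_phi x y).continuousAt

lemma strictAntiOn_phi_left (y : ℝ) :
    StrictAntiOn (fun x => phi x y) (Set.Icc Real.pi (2 * Real.pi)) := by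
  refine strictAntiOn_of_deriv_neg (convex_Icc _ _) (continuous_phi_left y).continuousOn ?_
  intro x hx
  rw [interior_Icc] at hx
  rw [(hasDerivAt_phi x y).deriv]
  have hsin : Real.sin x < 0 := by
    rw [← Real.sin_sub_two_pi]
    exact Real.sin_neg_of_neg_of_neg_pi_lt (by linarith [hx.2]) (by linarith [hx.1])
  exact mul_neg_of_pos_of_neg (by positivity) hsin

lemma phi_pi (y : ℝ) : phi Real.pi y = 1 + Real.exp (Real.pi * y) := by
  simp [phi]

lemma phi_two_pi (y : ℝ) : phi (2 * Real.pi) y = 1 - Real.exp (2 * Real.pi * y) := by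
  simp [phi]

/-- For every `y > 0`: the function `x ↦ φ(x,y)` is strictly decreasing on `[π, 2π]`,
satisfies `φ(π,y) = 1 + exp(π·y) > 0` and `φ(2π,y) = 1 − exp(2π·y) < 0`, and consequently
there exists a unique `x̂ ∈ (π, 2π)` with `φ(x̂,y) = 0`. -/
theorem stmt_2 (y : ℝ) (hy : 0 < y) :
    StrictAntiOn (fun x => phi x y) (Set.Icc Real.pi (2 * Real.pi)) ∧
    phi Real.pi y = 1 + Real.exp (Real.pi * y) ∧
    0 < phi Real.pi y ∧
    phi (2 * Real.pi) y = 1 - Real.exp (2 * Real.pi * y) ∧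
    phi (2 * Real.pi) y < 0 ∧
    ∃! x : ℝ, x ∈ Set.Ioo Real.pi (2 * Real.pi) ∧ phi x y = 0 := by
  have hpos : 0 < phi Real.pi y := by
    rw [phi_pi]
    positivity
  have hneg : phi (2 * Real.pi) y < 0 := by
    rw [phi_two_pi, sub_neg, Real.one_lt_exp_iff]
    positivity
  have hanti := strictAntiOn_phi_left y
  refine ⟨hanti, phi_pi y, hpos, phi_two_pi y, hneg, ?_⟩
  obtain ⟨x, hx, hx0⟩ := intermediate_value_Ioo' (by linarith [Real.pi_pos])
    (continuous_phi_left y).continuousOn ⟨hneg, hpos⟩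
  refine ⟨x, ⟨hx, hx0⟩, fun z hz => ?_⟩
  exact hanti.injOn (Set.Ioo_subset_Icc_self hz.1) (Set.Ioo_subset_Icc_self hx)
    (hz.2.trans hx0.symm)
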